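/- Let d ≥ 3 be odd and let z, z' : {1,…,d}×{1,…,d} → 𝔽₂ each have Hamming weight at most (d−1)/2. If z and z' produce the same syndrome (i.e., every check of the fixed-stabilizer check system of the new XY-code state-preparation protocol takes the same value on z as on z', equivalently z+z' has zero syndrome), then z+z' lies in the 𝔽₂-linear span of the indicator functions of the fixed-Y blocks. In particular any pattern of at most (d−1)/2 Z errors is correctable up to operators acting trivially on the GHZ-initialized state. -/

import Mathlib

/-- Extend a grid `z : Fin d → Fin d → ZMod 2` to all of `ℕ × ℕ` (0-based indices),
returning `0` outside the grid.  All accesses below are in range. -/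
def zext {d : ℕ} (z : Fin d → Fin d → ZMod 2) (i j : ℕ) : ZMod 2 :=
  if h : i < d ∧ j < d then z ⟨i, h.1⟩ ⟨j, h.2⟩ else 0

/-- The fixed-stabilizer check system of the new XY-code state-preparation
protocol (1-based indices of the paper shifted to 0-based): the top-boundary
checks (T), the left-boundary checks (L), the right-boundary checks (R), the
fixed four-body X-stabilizer checks (X4, faces with `r + c` even) and the fixed
four-body Y-stabilizer checks (Y4, faces with `r` even and `c` odd).  `z` has
zero syndrome if it satisfies all of these parity checks. -/
def ZeroSyndrome {d : ℕ} (z : Fin d → Fin d → ZMod 2) : Prop :=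
  (∀ j, 1 ≤ j → j ≤ (d - 1) / 2 →
    zext z 0 (2 * j - 2) + zext z 0 (2 * j - 1) = 0) ∧
  (∀ i, 1 ≤ i → i ≤ (d - 1) / 2 →
    zext z (2 * i - 1) 0 + zext z (2 * i) 0 = 0) ∧
  (∀ i, 1 ≤ i → i ≤ (d - 1) / 2 →
    zext z (2 * i - 2) (d - 1) + zext z (2 * i - 1) (d - 1) = 0) ∧
  (∀ r c, 1 ≤ r → r ≤ d - 1 → 1 ≤ c → c ≤ d - 1 → (r + c) % 2 = 0 →
    zext z (r - 1) (c - 1) + zext z (r - 1) c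
      + zext z r (c - 1) + zext z r c = 0) ∧
  (∀ r c, 1 ≤ r → r ≤ d - 1 → 1 ≤ c → c ≤ d - 1 → r % 2 = 0 → c % 2 = 1 →
    zext z (r - 1) (c - 1) + zext z (r - 1) c
      + zext z r (c - 1) + zext z r c = 0)

/-- Hamming weight of a phase-error pattern: the number of sites where it
equals `1`. -/
def wt {d : ℕ} (z : Fin d → Fin d → ZMod 2) : ℕ :=
  (Finset.univ.filter fun p : Fin d × Fin d => z p.1 p.2 = 1).card

/-- Indicator function of the two-element fixed-Y block
`{(1,2j−1),(1,2j)}` (1-based, shifted to 0-based). -/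
def topInd (d j : ℕ) : Fin d → Fin d → ZMod 2 := fun r c =>
  if r.val = 0 ∧ (c.val = 2 * j - 2 ∨ c.val = 2 * j - 1) then 1 else 0

/-- Indicator function of the four-element fixed-Y block
`{(2i,2j−1),(2i,2j),(2i+1,2j−1),(2i+1,2j)}` (1-based, shifted to 0-based). -/
def bulkInd (d i j : ℕ) : Fin d → Fin d → ZMod 2 := fun r c =>
  if (r.val = 2 * i - 1 ∨ r.val = 2 * i) ∧
      (c.val = 2 * j - 2 ∨ c.val = 2 * j - 1) then 1 else 0

/-- The set of indicator functions of all fixed-Y blocks. -/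
def blockIndicators (d : ℕ) : Set (Fin d → Fin d → ZMod 2) :=
  {f | (∃ j, 1 ≤ j ∧ j ≤ (d - 1) / 2 ∧ f = topInd d j) ∨
       (∃ i j, 1 ≤ i ∧ i ≤ (d - 1) / 2 ∧ 1 ≤ j ∧ j ≤ (d - 1) / 2 ∧
          f = bulkInd d i j)}

theorem aux_four : ∀ a b c e : ZMod 2, a + b + c + e = 0 → a = b → c = e := by decide

theorem aux_four2 : ∀ a b c e : ZMod 2, a + b + c + e = 0 → a = c → b = e := by decide

theorem aux_two : ∀ a b : ZMod 2, a + b = 0 → a = b := by decide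

theorem aux_pairs {d : ℕ} (hd : 3 ≤ d) (hodd : d % 2 = 1) (w : Fin d → Fin d → ZMod 2)
    (h : ZeroSyndrome w) (r : ℕ) (hr : r < d) (j : ℕ) (hj : j < (d - 1) / 2) :
    zext w r (2 * j) = zext w r (2 * j + 1) := by
  obtain ⟨hT, hL, hR, hX, hY⟩ := h
  induction r with
  | zero => exact aux_two _ _ (hT (j + 1) (by omega) (by omega))
  | succ r ih =>
    have ih := ih (by omega)
    refine aux_four _ _ _ _ ?_ ih
    rcases Nat.mod_two_eq_zero_or_one (r + 1) with h0 | h1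
    · exact hY (r + 1) (2 * j + 1) (by omega) (by omega) (by omega) (by omega) h0 (by omega)
    · exact hX (r + 1) (2 * j + 1) (by omega) (by omega) (by omega) (by omega) (by omega)

theorem aux_rows {d : ℕ} (hd : 3 ≤ d) (hodd : d % 2 = 1) (w : Fin d → Fin d → ZMod 2)
    (h : ZeroSyndrome w) (c : ℕ) (hc : c < d) (i : ℕ) (hi : i < (d - 1) / 2) :
    zext w (2 * i + 1) c = zext w (2 * i + 2) c := by
  have hA := aux_pairs hd hodd w h
  obtain ⟨hT, hL, hR, hX, hY⟩ := h
  induction c with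
  | zero => exact aux_two _ _ (hL (i + 1) (by omega) (by omega))
  | succ c ih =>
    have ih := ih (by omega)
    rcases Nat.mod_two_eq_zero_or_one c with h0 | h1
    · obtain ⟨j, rfl⟩ : ∃ j, c = 2 * j := ⟨c / 2, by omega⟩
      rw [← hA _ (by omega) j (by omega), ← hA _ (by omega) j (by omega), ih]
    · exact aux_four2 _ _ _ _
        (hX (2 * i + 2) (c + 1) (by omega) (by omega) (by omega) (by omega) (by omega)) ih

theorem aux_last {d : ℕ} (hd : 3 ≤ d) (hodd : d % 2 = 1) (w : Fin d → Fin d → ZMod 2)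
    (h : ZeroSyndrome w) (r : ℕ) (hr : r < d) :
    zext w r (d - 1) = zext w 0 (d - 1) := by
  have hB := aux_rows hd hodd w h (d - 1) (by omega)
  obtain ⟨hT, hL, hR, hX, hY⟩ := h
  induction r with
  | zero => rfl
  | succ r ih =>
    rw [← ih (by omega)]
    rcases Nat.mod_two_eq_zero_or_one r with h0 | h1
    · obtain ⟨i, rfl⟩ : ∃ i, r = 2 * i := ⟨r / 2, by omega⟩
      exact (aux_two _ _ (hR (i + 1) (by omega) (by omega))).symm
    · obtain ⟨i, rfl⟩ : ∃ i, r = 2 * i + 1 := ⟨r / 2, by omega⟩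
      exact (hB i (by omega)).symm

theorem aux_wt {d : ℕ} (z z' : Fin d → Fin d → ZMod 2) : wt (z + z') ≤ wt z + wt z' := by
  unfold wt
  refine le_trans (Finset.card_le_card ?_) (Finset.card_union_le _ _)
  intro p hp
  simp only [Finset.mem_filter, Finset.mem_univ, true_and, Finset.mem_union, Pi.add_apply] at hp ⊢
  revert hp
  generalize z p.1 p.2 = a
  generalize z' p.1 p.2 = b
  revert a b
  decide

theorem aux_span {d : ℕ} (hd : 3 ≤ d) (hodd : d % 2 = 1) (w : Fin d → Fin d → ZMod 2)
    (h : ZeroSyndrome w) (h0 : zext w 0 (d - 1) = 0) :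
    w ∈ Submodule.span (ZMod 2) (blockIndicators d) := by
  have hA := aux_pairs hd hodd w h
  have hB := aux_rows hd hodd w h
  have hC := aux_last hd hodd w h
  have key : w = ∑ j ∈ Finset.range ((d - 1) / 2), zext w 0 (2 * j) • topInd d (j + 1) +
      ∑ i ∈ Finset.range ((d - 1) / 2), ∑ j ∈ Finset.range ((d - 1) / 2),
        zext w (2 * i + 1) (2 * j) • bulkInd d (i + 1) (j + 1) := by
    funext r c
    have hw : w r c = zext w r c := by simp [zext]
    have hr := r.2
    have hc := c.2
    rw [hw]
    simp only [Pi.add_apply, Finset.sum_apply, Pi.smul_apply, smul_eq_mul]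
    by_cases hcd : c.val = d - 1
    · rw [hcd, hC r hr, h0, Finset.sum_eq_zero, Finset.sum_eq_zero, add_zero]
      · intro i hi
        refine Finset.sum_eq_zero fun j hj => ?_
        rw [Finset.mem_range] at hi hj
        rw [bulkInd, if_neg (by omega), mul_zero]
      · intro j hj
        rw [Finset.mem_range] at hj
        rw [topInd, if_neg (by omega), mul_zero]
    · have hcol : ∀ s < d, zext w s c = zext w s (2 * (c.val / 2)) := by
        intro s hs
        rcases Nat.mod_two_eq_zero_or_one c.val with e | e
        · congr 1; omega
        · rw [hA s hs (c.val / 2) (by omega)]; congr 1; omega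
      rw [hcol r hr]
      by_cases hr0 : r.val = 0
      · have e2 : (∑ i ∈ Finset.range ((d - 1) / 2), ∑ j ∈ Finset.range ((d - 1) / 2),
            zext w (2 * i + 1) (2 * j) * bulkInd d (i + 1) (j + 1) r c) = 0 := by
          refine Finset.sum_eq_zero fun i hi => Finset.sum_eq_zero fun j hj => ?_
          rw [bulkInd, if_neg (by omega), mul_zero]
        rw [e2, add_zero, Finset.sum_eq_single (c.val / 2)]
        · rw [topInd, if_pos (by omega), mul_one, hr0]
        · intro j _ hj
          rw [topInd, if_neg (by omega), mul_zero]
        · intro hn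
          rw [Finset.mem_range] at hn
          omega
      · have e1 : (∑ j ∈ Finset.range ((d - 1) / 2),
            zext w 0 (2 * j) * topInd d (j + 1) r c) = 0 := by
          refine Finset.sum_eq_zero fun j hj => ?_
          rw [topInd, if_neg (by omega), mul_zero]
        rw [e1, zero_add, Finset.sum_eq_single ((r.val - 1) / 2),
          Finset.sum_eq_single (c.val / 2)]
        · rw [bulkInd, if_pos (by omega), mul_one]
          rcases Nat.mod_two_eq_zero_or_one r.val with e | e
          · rw [hB _ (by omega) ((r.val - 1) / 2) (by omega)]; congr 1; omega
          · congr 1; omega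
        · intro j _ hj
          rw [bulkInd, if_neg (by omega), mul_zero]
        · intro hn
          rw [Finset.mem_range] at hn
          omega
        · intro i _ hi
          refine Finset.sum_eq_zero fun j hj => ?_
          rw [bulkInd, if_neg (by omega), mul_zero]
        · intro hn
          rw [Finset.mem_range] at hn
          omega
  rw [key]
  refine Submodule.add_mem _ (Submodule.sum_mem _ fun j hj => ?_)
    (Submodule.sum_mem _ fun i hi => Submodule.sum_mem _ fun j hj => ?_)
  · rw [Finset.mem_range] at hj
    exact Submodule.smul_mem _ _ (Submodule.subset_span
      (Or.inl ⟨j + 1, by omega, by omega, rfl⟩))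
  · rw [Finset.mem_range] at hi hj
    exact Submodule.smul_mem _ _ (Submodule.subset_span
      (Or.inr ⟨i + 1, j + 1, by omega, by omega, by omega, by omega, rfl⟩))


/-- If two phase-error patterns of Hamming weight at most `(d−1)/2` produce
the same syndrome (equivalently, `z + z'` has zero syndrome), then their sum
lies in the `𝔽₂`-linear span of the fixed-Y block indicators; so any pattern of
at most `(d−1)/2` `Z` errors is correctable up to operators acting trivially on
the GHZ-initialized state. -/
theorem low_weight_correctable (d : ℕ) (hd : 3 ≤ d) (hodd : d % 2 = 1)
    (z z' : Fin d → Fin d → ZMod 2)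
    (hz : wt z ≤ (d - 1) / 2) (hz' : wt z' ≤ (d - 1) / 2)
    (hsyn : ZeroSyndrome (z + z')) :
    z + z' ∈ Submodule.span (ZMod 2) (blockIndicators d) := by
  have hC := aux_last hd hodd _ hsyn
  apply aux_span hd hodd _ hsyn
  by_contra hne
  have h1 : zext (z + z') 0 (d - 1) = 1 := by
    revert hne
    generalize zext (z + z') 0 (d - 1) = a
    revert a
    decide
  have hw : d ≤ wt (z + z') := by
    unfold wt
    have := Finset.card_le_card_of_injOn (s := (Finset.univ : Finset (Fin d)))
      (t := Finset.univ.filter fun p : Fin d × Fin d => (z + z') p.1 p.2 = 1)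
      (fun r => (r, (⟨d - 1, by omega⟩ : Fin d)))
      (by
        intro r _
        have h2 := hC r r.2
        rw [h1, zext, dif_pos ⟨r.2, by omega⟩] at h2
        simpa using h2)
      (by
        intro a _ b _ hab
        exact (Prod.mk.inj hab).1)
    simpa using this
  have := aux_wt z z'
  omega
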